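/- Let n ≥ 3, let K ⊂ ℝ^n be a strictly convex body that is centrally symmetric with center at the origin (K = −K), and let L be the image of a topological embedding of the sphere S^{n−1} into ℝ^n such that K is contained in a bounded connected component of ℝ^n \ L (in particular L ∩ K = ∅). Suppose that for every x ∈ L there exist y ∈ L with y ≠ x and p ∈ ℝ^n such that C_y = p + C_x. Then L = −L; that is, L is centrally symmetric with the same center as K. -/

import Mathlib

open Set Metric RealInnerProductSpace

noncomputable section

/-- Euclidean space ℝ^n. -/
abbrev Euc (n : ℕ) := EuclideanSpace ℝ (Fin n)

/-- The solid double-cone generated by a convex body `K` and a point `x`: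
the union of all lines through `x` and a point of `K`. -/
def solidCone {n : ℕ} (K : Set (Euc n)) (x : Euc n) : Set (Euc n) :=
  ⋃ y ∈ K, (affineSpan ℝ ({x, y} : Set (Euc n)) : Set (Euc n))

/-- The support double-cone of `K` with apex `x`: the topological frontier of
the solid double-cone. -/
def supportCone {n : ℕ} (K : Set (Euc n)) (x : Euc n) : Set (Euc n) :=
  frontier (solidCone K x)

/-- A convex body: a compact convex set with nonempty interior. -/
def IsConvexBody {n : ℕ} (K : Set (Euc n)) : Prop :=
  IsCompact K ∧ Convex ℝ K ∧ (interior K).Nonempty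

/-- `M` is the image of a topological embedding of the sphere `S^m ⊆ ℝ^(m+1)`
into ℝ^n: a continuous injective map from the unit sphere with range `M`
(such a map from the compact sphere is automatically a homeomorphism onto its
image). -/
def IsSphereEmbeddingImage {n : ℕ} (m : ℕ) (M : Set (Euc n)) : Prop :=
  ∃ f : Metric.sphere (0 : Euc (m + 1)) 1 → Euc n,
    Continuous f ∧ Function.Injective f ∧ Set.range f = M

section helpers

variable {E : Type*} [NormedAddCommGroup E] [NormedSpace ℝ E]

/-- The double cone of directions from `x` to `K`. -/
def dirCone (K : Set E) (x : E) : Set E := {v | ∃ t : ℝ, ∃ k ∈ K, v = t • (k - x)}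

/-- The positive cone of directions from `x` to `K`. -/
def posCone (K : Set E) (x : E) : Set E := {v | ∃ t : ℝ, 0 ≤ t ∧ ∃ k ∈ K, v = t • (k - x)}

lemma dir_sep {K : Set E} (hc : IsCompact K) (hv : Convex ℝ K) {x : E} (hx : x ∉ K) :
    ∃ f : E →L[ℝ] ℝ, ∃ c : ℝ, 0 < c ∧ ∀ k ∈ K, c ≤ f (k - x) := by
  obtain ⟨f, u, h1, h2⟩ := geometric_hahn_banach_point_closed hv hc.isClosed hx
  refine ⟨f, u - f x, by linarith, fun k hk => ?_⟩
  rw [map_sub]; linarith [h2 k hk]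

lemma dir_smul {K : Set E} {x v : E} (r : ℝ) (h : v ∈ dirCone K x) : r • v ∈ dirCone K x := by
  obtain ⟨t, k, hk, rfl⟩ := h
  exact ⟨r * t, k, hk, by rw [smul_smul]⟩

lemma dir_smul_iff {K : Set E} {x v : E} {r : ℝ} (hr : r ≠ 0) :
    r • v ∈ dirCone K x ↔ v ∈ dirCone K x :=
  ⟨fun h => by simpa [smul_smul, inv_mul_cancel₀ hr] using dir_smul r⁻¹ h, dir_smul r⟩

lemma dir_ker {K : Set E} {x v : E} {f : E →L[ℝ] ℝ} {c : ℝ} (hc : 0 < c)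
    (hf : ∀ k ∈ K, c ≤ f (k - x)) (h : v ∈ dirCone K x) (h0 : f v = 0) : v = 0 := by
  obtain ⟨t, k, hk, rfl⟩ := h
  have := hf k hk
  rw [map_smul, smul_eq_mul, mul_eq_zero] at h0
  rcases h0 with h0 | h0
  · simp [h0]
  · linarith

lemma pos_iff {K : Set E} {x v : E} {f : E →L[ℝ] ℝ} {c : ℝ} (hc : 0 < c)
    (hf : ∀ k ∈ K, c ≤ f (k - x)) : v ∈ posCone K x ↔ v ∈ dirCone K x ∧ 0 ≤ f v := by
  constructor
  · rintro ⟨t, ht, k, hk, rfl⟩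
    refine ⟨⟨t, k, hk, rfl⟩, ?_⟩
    have := hf k hk
    rw [map_smul, smul_eq_mul]
    exact mul_nonneg ht (by linarith)
  · rintro ⟨⟨t, k, hk, rfl⟩, h⟩
    have := hf k hk
    rw [map_smul, smul_eq_mul] at h
    exact ⟨t, nonneg_of_mul_nonneg_left h (by linarith), k, hk, rfl⟩

lemma pos_add {K : Set E} (hv : Convex ℝ K) {x v w : E} (h1 : v ∈ posCone K x)
    (h2 : w ∈ posCone K x) : v + w ∈ posCone K x := by
  obtain ⟨t, ht, k, hk, rfl⟩ := h1
  obtain ⟨s, hs, l, hl, rfl⟩ := h2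
  rcases eq_or_lt_of_le (add_nonneg ht hs) with h | h
  · have : t = 0 := by linarith
    have : s = 0 := by linarith
    subst_vars
    exact ⟨0, le_rfl, k, hk, by simp⟩
  · refine ⟨t + s, h.le, (t / (t + s)) • k + (s / (t + s)) • l,
      hv hk hl (by positivity) (by positivity) (by field_simp), ?_⟩
    have e1 : (t + s) * (t / (t + s)) = t := by field_simp
    have e2 : (t + s) * (s / (t + s)) = s := by field_simp
    rw [smul_sub (t + s), smul_add (t + s), smul_smul, smul_smul, e1, e2]
    module

lemma pos_smul {K : Set E} {x v : E} {r : ℝ} (hr : 0 ≤ r) (h1 : v ∈ posCone K x) :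
    r • v ∈ posCone K x := by
  obtain ⟨t, ht, k, hk, rfl⟩ := h1
  exact ⟨r * t, mul_nonneg hr ht, k, hk, by rw [smul_smul]⟩

lemma pos_sub_dir {K : Set E} {x v : E} (h : v ∈ posCone K x) : v ∈ dirCone K x := by
  obtain ⟨t, ht, k, hk, rfl⟩ := h
  exact ⟨t, k, hk, rfl⟩

lemma dir_closed {K : Set E} (hK : IsCompact K) {x : E} {f : E →L[ℝ] ℝ} {c : ℝ} (hc : 0 < c)
    (hf : ∀ k ∈ K, c ≤ f (k - x)) : IsClosed (dirCone K x) := by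
  haveI : CompactSpace K := isCompact_iff_compactSpace.mp hK
  have hcl : IsClosed {p : (Set.Icc (0:ℝ) 1 × K) × E |
      p.2 = ((p.1.1 : ℝ) * f p.2 / c) • ((p.1.2 : E) - x)} :=
    isClosed_eq (by fun_prop) (by fun_prop)
  have := isClosedMap_snd_of_compactSpace _ hcl
  convert this using 1
  ext v
  constructor
  · rintro ⟨t, k, hk, rfl⟩
    have h := hf k hk
    have h' : 0 < f (k - x) := by linarith
    refine ⟨((⟨c / f (k - x), by positivity, (div_le_one h').2 h⟩, ⟨k, hk⟩), t • (k - x)), ?_, rfl⟩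
    simp only [mem_setOf_eq, map_smul, smul_eq_mul]
    congr 1
    field_simp
  · rintro ⟨⟨⟨s, k⟩, w⟩, h, rfl⟩
    exact ⟨_, k, k.2, h⟩

lemma precon_disj {O D : Set E} (hO : IsPreconnected O) (hd : ∀ v ∈ O, v ∉ frontier D)
    {w : E} (hw : w ∈ O) (hwD : w ∉ D) : ∀ v ∈ O, v ∉ D := by
  intro v hv hvD
  have hsub : O ⊆ interior D ∪ (closure D)ᶜ := by
    intro z hz
    by_cases h : z ∈ interior D
    · exact Or.inl h
    · exact Or.inr fun h' => hd z hz ⟨h', h⟩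
  have hdis : Disjoint (interior D) (closure D)ᶜ :=
    disjoint_compl_right_iff_subset.2 (interior_subset.trans subset_closure)
  rcases hO.subset_or_subset isOpen_interior isClosed_closure.isOpen_compl hdis hsub with h | h
  · exact hwD (interior_subset (h hw))
  · exact h hv (subset_closure hvD)

variable [FiniteDimensional ℝ E]

lemma ker_dim (h3 : 3 ≤ Module.finrank ℝ E) (f : E →L[ℝ] ℝ) :
    2 ≤ Module.finrank ℝ (LinearMap.ker (f : E →ₗ[ℝ] ℝ)) := by
  have h := LinearMap.finrank_range_add_finrank_ker (f : E →ₗ[ℝ] ℝ)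
  have h2 := Submodule.finrank_le (LinearMap.range (f : E →ₗ[ℝ] ℝ))
  rw [Module.finrank_self] at h2
  omega

lemma ker_ne (h3 : 3 ≤ Module.finrank ℝ E) (f : E →L[ℝ] ℝ) : ∃ v, v ≠ 0 ∧ f v = 0 := by
  have h := ker_dim h3 f
  haveI : Nontrivial (LinearMap.ker (f : E →ₗ[ℝ] ℝ)) :=
    Module.nontrivial_of_finrank_pos (R := ℝ) (by omega)
  obtain ⟨v, hv⟩ := exists_ne (0 : LinearMap.ker (f : E →ₗ[ℝ] ℝ))
  exact ⟨v, by simpa using hv, v.2⟩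

lemma ker_con (h3 : 3 ≤ Module.finrank ℝ E) (f : E →L[ℝ] ℝ) :
    IsPreconnected {v : E | f v = 0 ∧ v ≠ 0} := by
  have h := ker_dim h3 f
  have h1 : 1 < Module.rank ℝ (LinearMap.ker (f : E →ₗ[ℝ] ℝ)) := by
    rw [← Module.finrank_eq_rank]; exact_mod_cast h
  have := (isConnected_compl_singleton_of_one_lt_rank h1 0).isPreconnected.image
    (Subtype.val) continuous_subtype_val.continuousOn
  convert this using 1
  ext v
  constructor
  · rintro ⟨a, b⟩
    exact ⟨⟨v, a⟩, fun h => b (congrArg Subtype.val h), rfl⟩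
  · rintro ⟨w, hw, rfl⟩
    exact ⟨w.2, by simpa using hw⟩

lemma open_not_span (h3 : 3 ≤ Module.finrank ℝ E) {K : Set E} (hi : (interior K).Nonempty)
    (x d : E) : ∃ k ∈ interior K, k - x ∉ Submodule.span ℝ {d} := by
  by_contra! H
  have ho : IsOpen ((fun v => x + v) ⁻¹' interior K) :=
    isOpen_interior.preimage (by fun_prop)
  have hsub : ((fun v => x + v) ⁻¹' interior K) ⊆ (Submodule.span ℝ {d} : Set E) := by
    intro v hv
    simpa using H _ hv
  obtain ⟨k, hk⟩ := hi
  have hne : (interior (Submodule.span ℝ {d} : Set E)).Nonempty :=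
    ⟨k - x, interior_maximal hsub ho (by simpa using hk)⟩
  have htop := Submodule.eq_top_of_nonempty_interior' _ hne
  have h1 : Module.finrank ℝ (Submodule.span ℝ {d}) ≤ 1 := by
    simpa using finrank_span_le_card (R := ℝ) ({d} : Set E)
  rw [htop, finrank_top] at h1
  omega

lemma span_con (h3 : 3 ≤ Module.finrank ℝ E) (d : E) :
    IsPreconnected ((Submodule.span ℝ {d} : Set E)ᶜ) := by
  apply (isConnected_compl_of_one_lt_codim _).isPreconnected
  have h1 : Module.finrank ℝ (Submodule.span ℝ {d}) ≤ 1 := by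
    simpa using finrank_span_le_card (R := ℝ) ({d} : Set E)
  have h2 := Submodule.finrank_quotient_add_finrank (Submodule.span ℝ {d})
  rw [← Module.finrank_eq_rank]
  have : 1 < Module.finrank ℝ (E ⧸ Submodule.span ℝ {d}) := by omega
  exact_mod_cast this

lemma compl_con (h3 : 3 ≤ Module.finrank ℝ E) {K : Set E} (hv : Convex ℝ K) (hne : K.Nonempty)
    {x : E} {f : E →L[ℝ] ℝ} {c : ℝ} (hc : 0 < c)
    (hf : ∀ k ∈ K, c ≤ f (k - x)) : IsPreconnected (dirCone K x)ᶜ := by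
  obtain ⟨k0, hk0⟩ := hne
  obtain ⟨z, hz0, hz⟩ := ker_ne h3 f
  have h0 : 0 < f (k0 - x) := lt_of_lt_of_le hc (hf k0 hk0)
  have hker : {v : E | f v = 0 ∧ v ≠ 0} ⊆ (dirCone K x)ᶜ :=
    fun v hv hD => hv.2 (dir_ker hc hf hD hv.1)
  have hposv : ∀ v ∉ dirCone K x, 0 ≤ f v → ∃ w, f w = 0 ∧ w ≠ 0 ∧
      segment ℝ v w ⊆ (dirCone K x)ᶜ := by
    intro v hvD hfv
    set g : E := (f v / f (k0 - x)) • (k0 - x) with hg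
    have hgP : g ∈ posCone K x := ⟨_, by positivity, k0, hk0, rfl⟩
    have hfg : f g = f v := by
      rw [hg, map_smul, smul_eq_mul]; field_simp
    refine ⟨v - g, by rw [map_sub, hfg, sub_self], ?_, ?_⟩
    · intro h
      rw [sub_eq_zero] at h
      exact hvD (h ▸ pos_sub_dir hgP)
    · rintro _ ⟨a, b, ha, hb, hab, rfl⟩ hD
      have e : a • v + b • (v - g) = v - b • g := by
        have : a = 1 - b := by linarith
        subst this; module
      rw [e] at hD
      have hp : v - b • g ∈ posCone K x := by
        rw [pos_iff hc hf]
        refine ⟨hD, ?_⟩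
        rw [map_sub, map_smul, hfg, smul_eq_mul]
        nlinarith
      have := pos_add hv hp (pos_smul hb hgP)
      rw [sub_add_cancel] at this
      exact hvD (pos_sub_dir this)
  have hall : ∀ v ∉ dirCone K x, ∃ w, f w = 0 ∧ w ≠ 0 ∧
      segment ℝ v w ⊆ (dirCone K x)ᶜ := by
    intro v hvD
    rcases le_total 0 (f v) with h | h
    · exact hposv v hvD h
    · have hn : -v ∉ dirCone K x := fun h' => hvD (by simpa using dir_smul (-1) h')
      obtain ⟨w, h1, h2, hs⟩ := hposv (-v) hn (by rw [map_neg]; linarith)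
      refine ⟨-w, by simp [h1], by simpa using h2, ?_⟩
      rintro _ ⟨a, b, ha, hb, hab, rfl⟩ hD
      refine hs ⟨a, b, ha, hb, hab, rfl⟩ ?_
      have := dir_smul (-1) hD
      convert this using 1
      module
  refine isPreconnected_of_forall z fun v hvD => ?_
  obtain ⟨w, h1, h2, hs⟩ := hall v hvD
  refine ⟨{v : E | f v = 0 ∧ v ≠ 0} ∪ segment ℝ v w, union_subset hker hs, Or.inl ⟨hz, hz0⟩,
    Or.inr (left_mem_segment ℝ v w), ?_⟩
  exact (ker_con h3 f).union w ⟨h1, h2⟩ (right_mem_segment ℝ v w)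
    (convex_segment v w).isPreconnected

lemma frontier_dir_smul {K : Set E} {x v : E} {r : ℝ} (hr : r ≠ 0)
    (h : v ∈ frontier (dirCone K x)) : r • v ∈ frontier (dirCone K x) := by
  have h1 := (Homeomorph.smulOfNeZero (α := E) r hr).preimage_frontier (dirCone K x)
  have h2 : (Homeomorph.smulOfNeZero (α := E) r hr) ⁻¹' dirCone K x = dirCone K x := by
    ext v
    exact dir_smul_iff hr
  rw [h2] at h1
  rw [← h1] at h
  exact h

/-- The apex of a support cone is determined. -/
lemma apex (h3 : 3 ≤ Module.finrank ℝ E) {K : Set E} (hK : IsCompact K) (hv : Convex ℝ K)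
    (hi : (interior K).Nonempty) {x y q : E} (hx : x ∉ K)
    (hF : ∀ v, q + v ∈ frontier (dirCone K y) ↔ v ∈ frontier (dirCone K x)) : q = 0 := by
  obtain ⟨f, c, hc, hf⟩ := dir_sep hK hv hx
  by_contra hq
  have hcl := dir_closed hK hc hf
  obtain ⟨z, hz0, hz⟩ := ker_ne h3 f
  have hzD : z ∉ dirCone K x := fun h => hz0 (dir_ker hc hf h hz)
  have step : ∀ v ∈ frontier (dirCone K x), ∀ r : ℝ, r ≠ 0 →
      (r - 1) • q + v ∈ frontier (dirCone K x) := by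
    intro v hvF r hr
    have h1 := (hF _).2 (frontier_dir_smul (inv_ne_zero hr) hvF)
    have h2 := frontier_dir_smul hr h1
    rw [smul_add, smul_smul, mul_inv_cancel₀ hr, one_smul] at h2
    rw [← hF]
    convert h2 using 1
    module
  have trans : ∀ v ∈ frontier (dirCone K x), ∀ t : ℝ, t • q + v ∈ frontier (dirCone K x) := by
    intro v hvF t
    by_cases ht : t = -1
    · have h1 := step _ (step v hvF (1/2) (by norm_num)) (1/2) (by norm_num)
      convert h1 using 1
      subst ht
      module
    · have h1 := step v hvF (t + 1) (fun h => ht (by linarith))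
      simpa using h1
  obtain ⟨k0, hk0⟩ := hi
  have h0F : (0 : E) ∈ frontier (dirCone K x) := by
    refine ⟨subset_closure ⟨0, k0, interior_subset hk0, by simp⟩, fun h => ?_⟩
    have ht : Filter.Tendsto (fun t : ℝ => t • z) (nhdsWithin 0 {0}ᶜ) (nhds 0) := by
      have : Continuous (fun t : ℝ => t • z) := by fun_prop
      have h := this.tendsto 0
      rw [zero_smul] at h
      exact h.mono_left nhdsWithin_le_nhds
    have h1 := ht.eventually (mem_interior_iff_mem_nhds.1 h)
    have h2 : ∀ᶠ t : ℝ in nhdsWithin 0 {0}ᶜ, t ≠ 0 := eventually_mem_nhdsWithin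
    obtain ⟨t, ht1, ht2⟩ := (h1.and h2).exists
    exact hzD ((dir_smul_iff ht2).1 ht1)
  have hFD : frontier (dirCone K x) ⊆ dirCone K x := hcl.frontier_subset
  have hqD : q ∈ dirCone K x := by
    have := hFD (trans 0 h0F 1)
    simpa using this
  have hfq : f q ≠ 0 := fun h => hq (dir_ker hc hf hqD h)
  have hspan : ∀ v ∈ frontier (dirCone K x), v ∈ Submodule.span ℝ {q} := by
    intro v hvF
    have h1 := hFD (trans v hvF (-(f v / f q)))
    have h2 := dir_ker hc hf h1 (by
      rw [map_add, map_smul, smul_eq_mul]; field_simp; ring)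
    rw [Submodule.mem_span_singleton]
    refine ⟨f v / f q, ?_⟩
    rw [neg_smul, neg_add_eq_zero] at h2
    exact h2
  have hzs : z ∉ Submodule.span ℝ {q} := by
    rw [Submodule.mem_span_singleton]
    rintro ⟨a, rfl⟩
    exact hzD (dir_smul a hqD)
  have hdis := precon_disj (span_con h3 q) (fun v hvO hvF => hvO (hspan v hvF)) hzs hzD
  obtain ⟨k, hk, hks⟩ := open_not_span h3 ⟨k0, hk0⟩ x q
  exact hdis _ hks ⟨1, k, interior_subset hk, by simp⟩

lemma dir_sub (h3 : 3 ≤ Module.finrank ℝ E) {K : Set E} (hK : IsCompact K) (hv : Convex ℝ K)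
    (hi : K.Nonempty) {x y : E} (hx : x ∉ K) (hy : y ∉ K)
    (hF : frontier (dirCone K y) = frontier (dirCone K x)) : dirCone K y ⊆ dirCone K x := by
  obtain ⟨f, c, hc, hf⟩ := dir_sep hK hv hx
  obtain ⟨g, e, he, hg⟩ := dir_sep hK hv hy
  have hO := compl_con h3 hv hi hc hf
  have hcl := dir_closed hK hc hf
  by_contra hns
  obtain ⟨u, huy, hux⟩ := not_subset.1 hns
  have hdis : ∀ v ∈ (dirCone K x)ᶜ, v ∉ frontier (dirCone K y) := by
    intro v hvO h
    rw [hF] at h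
    exact hvO (hcl.frontier_subset h)
  have hun : -u ∈ (dirCone K x)ᶜ := fun h' => hux (by simpa using dir_smul (-1) h')
  have him := hO.image g g.continuous.continuousOn
  have hoc := him.ordConnected
  have h0 : (0:ℝ) ∈ g '' (dirCone K x)ᶜ := by
    rcases le_total 0 (g u) with h | h
    · exact hoc.out ⟨-u, hun, rfl⟩ ⟨u, hux, rfl⟩ ⟨by rw [map_neg]; linarith, h⟩
    · exact hoc.out ⟨u, hux, rfl⟩ ⟨-u, hun, rfl⟩ ⟨h, by rw [map_neg]; linarith⟩
  obtain ⟨w, hw, hgw⟩ := h0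
  have hw0 : w ≠ 0 := by
    rintro rfl
    obtain ⟨k, hk⟩ := hi
    exact hw ⟨0, k, hk, by simp⟩
  exact precon_disj hO hdis hw (fun h => hw0 (dir_ker he hg h hgw)) u hux huy

lemma pos_or (K : Set E) (hK : IsCompact K) (hv : Convex ℝ K)
    {x y : E} (hx : x ∉ K) (hy : y ∉ K)
    (hD : dirCone K y = dirCone K x) :
    posCone K x = posCone K y ∨ posCone K x = {v | -v ∈ posCone K y} := by
  obtain ⟨f, c, hc, hf⟩ := dir_sep hK hv hx
  obtain ⟨g, e, he, hg⟩ := dir_sep hK hv hy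
  have hoc := (hv.isPreconnected.image (fun k => g (k - x)) (by fun_prop)).ordConnected
  have hgne : ∀ k ∈ K, g (k - x) ≠ 0 := by
    intro k hk h
    have h1 : k - x ∈ dirCone K x := ⟨1, k, hk, by simp⟩
    have h2 := dir_ker he hg (hD ▸ h1) h
    rw [sub_eq_zero] at h2
    exact hx (h2 ▸ hk)
  have hsgn : (∀ k ∈ K, 0 < g (k - x)) ∨ (∀ k ∈ K, g (k - x) < 0) := by
    by_contra! ⟨⟨k, hk, h1⟩, ⟨l, hl, h2⟩⟩
    obtain ⟨m, hm, h⟩ := hoc.out ⟨k, hk, rfl⟩ ⟨l, hl, rfl⟩ ⟨h1, h2⟩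
    exact hgne m hm h
  rcases hsgn with h | h
  · left
    ext v
    rw [pos_iff he hg, hD]
    constructor
    · intro hvP
      refine ⟨pos_sub_dir hvP, ?_⟩
      obtain ⟨t, ht, k, hk, rfl⟩ := hvP
      rw [map_smul, smul_eq_mul]
      exact mul_nonneg ht (h k hk).le
    · rintro ⟨⟨t, k, hk, rfl⟩, h'⟩
      rw [map_smul, smul_eq_mul] at h'
      exact ⟨t, nonneg_of_mul_nonneg_left h' (h k hk), k, hk, rfl⟩
  · right
    ext v
    rw [mem_setOf_eq, pos_iff he hg, hD]
    constructor
    · intro hvP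
      refine ⟨by simpa using dir_smul (-1) (pos_sub_dir hvP), ?_⟩
      obtain ⟨t, ht, k, hk, rfl⟩ := hvP
      rw [map_neg, map_smul, smul_eq_mul]
      nlinarith [h k hk]
    · rintro ⟨h1, h'⟩
      have h2 : v ∈ dirCone K x := by simpa using dir_smul (-1) h1
      obtain ⟨t, k, hk, rfl⟩ := h2
      rw [map_neg, map_smul, smul_eq_mul] at h'
      refine ⟨t, ?_, k, hk, rfl⟩
      by_contra! ht
      nlinarith [h k hk]

lemma pos_apex_mem (h3 : 3 ≤ Module.finrank ℝ E) {K : Set E} (hK : IsCompact K)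
    (hv : Convex ℝ K) (hi : (interior K).Nonempty) {x y : E} (hx : x ∉ K)
    (hP : posCone K x = posCone K y) : y - x ∈ posCone K x := by
  obtain ⟨f, c, hc, hf⟩ := dir_sep hK hv hx
  by_contra hd
  set d := y - x with hdd
  obtain ⟨k, hk, hks⟩ := open_not_span h3 hi x d
  set w := k - x with hw
  have hwP : w ∈ posCone K x := ⟨1, zero_le_one, k, interior_subset hk, by simp [hw]⟩
  set R : Set ℝ := {r | 0 ≤ r ∧ d + r • w ∈ posCone K x} with hR
  have hRcl : IsClosed R := by
    have : R = Ici 0 ∩ {r | d + r • w ∈ dirCone K x} ∩ {r | 0 ≤ f (d + r • w)} := by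
      ext r
      simp only [hR, mem_setOf_eq, pos_iff hc hf, mem_inter_iff, mem_Ici, and_assoc]
    rw [this]
    refine (isClosed_Ici.inter ?_).inter ?_
    · exact (dir_closed hK hc hf).preimage (by fun_prop)
    · exact isClosed_le (by fun_prop) (by fun_prop)
  have hRne : R.Nonempty := by
    have ht : Filter.Tendsto (fun t : ℝ => k + t • d) (nhdsWithin 0 (Ioi 0)) (nhds k) := by
      have : Continuous (fun t : ℝ => k + t • d) := by fun_prop
      have h := this.tendsto 0
      rw [zero_smul, add_zero] at h
      exact h.mono_left nhdsWithin_le_nhds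
    have h1 := ht.eventually (mem_interior_iff_mem_nhds.1 hk)
    have h2 : ∀ᶠ t : ℝ in nhdsWithin 0 (Ioi 0), 0 < t := eventually_mem_nhdsWithin
    obtain ⟨t, ht1, ht2⟩ := (h1.and h2).exists
    refine ⟨t⁻¹, by positivity, t⁻¹, by positivity, _, ht1, ?_⟩
    have : k + t • d - x = t • d + w := by rw [hw]; module
    rw [this, smul_add, smul_smul, inv_mul_cancel₀ ht2.ne', one_smul]
  have hbdd : BddBelow R := ⟨0, fun r hr => hr.1⟩
  have hmin := hRcl.csInf_mem hRne hbdd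
  set r0 := sInf R
  obtain ⟨hr0, hr0P⟩ := hmin
  have hr0pos : 0 < r0 := by
    rcases eq_or_lt_of_le hr0 with h | h
    · rw [← h, zero_smul, add_zero] at hr0P
      exact absurd hr0P hd
    · exact h
  have hvne : d + r0 • w ≠ 0 := by
    intro h
    apply hks
    rw [Submodule.mem_span_singleton]
    refine ⟨-r0⁻¹, ?_⟩
    have : d = - (r0 • w) := eq_neg_of_add_eq_zero_left h
    rw [this, smul_neg, neg_smul, neg_neg, smul_smul, inv_mul_cancel₀ hr0pos.ne', one_smul]
  have hv' := hr0P
  rw [hP] at hv'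
  obtain ⟨t, ht, l, hl, hvl⟩ := hv'
  have htpos : 0 < t := by
    rcases eq_or_lt_of_le ht with h | h
    · rw [← h, zero_smul] at hvl
      exact absurd hvl hvne
    · exact h
  have hl1 : l - x ∈ posCone K x := ⟨1, zero_le_one, l, hl, by simp⟩
  have hl2 : l - x = d + t⁻¹ • (d + r0 • w) := by
    rw [hvl, smul_smul, inv_mul_cancel₀ htpos.ne', one_smul, hdd]
    abel
  have h3' := pos_smul (r := t / (t + 1)) (by positivity) hl1
  have h4 : (t / (t + 1)) • (l - x) = d + (r0 / (t + 1)) • w := by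
    rw [hl2, smul_add, smul_smul, smul_add, smul_smul, ← add_assoc, ← add_smul]
    have e1 : t / (t + 1) + t / (t + 1) * t⁻¹ = 1 := by field_simp
    have e2 : t / (t + 1) * t⁻¹ * r0 = r0 / (t + 1) := by field_simp
    rw [e1, e2, one_smul]
  rw [h4] at h3'
  have h5 : r0 ≤ r0 / (t + 1) := csInf_le hbdd ⟨by positivity, h3'⟩
  rw [le_div_iff₀ (by linarith)] at h5
  nlinarith

lemma pos_apex (h3 : 3 ≤ Module.finrank ℝ E) {K : Set E} (hK : IsCompact K)
    (hv : Convex ℝ K) (hi : (interior K).Nonempty) {x y : E} (hx : x ∉ K) (hy : y ∉ K)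
    (hP : posCone K x = posCone K y) : y = x := by
  obtain ⟨f, c, hc, hf⟩ := dir_sep hK hv hx
  have h1 := (pos_iff hc hf).1 (pos_apex_mem h3 hK hv hi hx hP)
  have h2 := pos_apex_mem h3 hK hv hi hy hP.symm
  rw [← hP, pos_iff hc hf] at h2
  have h0 : f (y - x) = 0 := by
    have := h2.2
    have h1' := h1.2
    rw [map_sub] at *
    linarith
  exact sub_eq_zero.1 (dir_ker hc hf h1.1 h0)

end helpers

lemma solidCone_eq {n : ℕ} (K : Set (Euc n)) (x : Euc n) :
    solidCone K x = (Homeomorph.addLeft x) '' dirCone K x := by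
  ext z
  simp only [solidCone, mem_iUnion, SetLike.mem_coe, mem_image, Homeomorph.coe_addLeft]
  constructor
  · rintro ⟨k, hk, hz⟩
    obtain ⟨t, rfl⟩ := (mem_affineSpan_pair_iff_exists_lineMap_eq).1 hz
    exact ⟨t • (k - x), ⟨t, k, hk, rfl⟩, by simp [AffineMap.lineMap_apply, add_comm]⟩
  · rintro ⟨_, ⟨t, k, hk, rfl⟩, rfl⟩
    refine ⟨k, hk, (mem_affineSpan_pair_iff_exists_lineMap_eq).2 ⟨t, ?_⟩⟩
    simp [AffineMap.lineMap_apply, add_comm]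

lemma mem_supportCone {n : ℕ} (K : Set (Euc n)) (x v : Euc n) :
    x + v ∈ supportCone K x ↔ v ∈ frontier (dirCone K x) := by
  rw [supportCone, solidCone_eq, ← Homeomorph.image_frontier]
  simp

/-- If `K` is a strictly convex body centrally symmetric about
the origin, `L` is an embedded (n-1)-sphere with `K` inside a bounded
component of `Lᶜ`, and every support cone with apex on `L` is a translate of
another one with apex on `L`, then `L = -L`. -/
theorem stmt_13 (n : ℕ) (hn : 3 ≤ n) (K L : Set (Euc n))
    (hK : IsConvexBody K) (hKs : StrictConvex ℝ K)
    (hsym : K = (fun z => -z) '' K)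
    (hL : IsSphereEmbeddingImage (n - 1) L)
    (hcomp : ∃ z ∈ Lᶜ, Bornology.IsBounded (connectedComponentIn Lᶜ z) ∧
      K ⊆ connectedComponentIn Lᶜ z)
    (hcone : ∀ x ∈ L, ∃ y ∈ L, y ≠ x ∧ ∃ p : Euc n,
      supportCone K y = (fun z => p + z) '' supportCone K x) :
    L = (fun z => -z) '' L := by
  have h3 : 3 ≤ Module.finrank ℝ (Euc n) := by simpa using hn
  obtain ⟨hKc, hKv, hKi⟩ := hK
  have hKne : K.Nonempty := hKi.mono interior_subset
  have hneg : ∀ k ∈ K, -k ∈ K := by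
    intro k hk
    rw [hsym]
    exact ⟨k, hk, rfl⟩
  have hLK : ∀ x ∈ L, x ∉ K := by
    obtain ⟨z, -, -, hz⟩ := hcomp
    intro x hx hxK
    exact connectedComponentIn_subset _ _ (hz hxK) hx
  have main : ∀ x ∈ L, -x ∈ L := by
    intro x hxL
    obtain ⟨y, hyL, hyx, p, hp⟩ := hcone x hxL
    have hx := hLK x hxL
    have hy := hLK y hyL
    have hF : ∀ v, (p + x - y) + v ∈ frontier (dirCone K y) ↔ v ∈ frontier (dirCone K x) := by
      intro v
      rw [← mem_supportCone, ← mem_supportCone, hp]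
      have : y + (p + x - y + v) = p + (x + v) := by abel
      rw [this]
      simp
    have hq := apex h3 hKc hKv hKi hx hF
    rw [hq] at hF
    have hFF : frontier (dirCone K y) = frontier (dirCone K x) := by
      ext v
      simpa using hF v
    have hD : dirCone K y = dirCone K x :=
      Subset.antisymm (dir_sub h3 hKc hKv hKne hx hy hFF)
        (dir_sub h3 hKc hKv hKne hy hx hFF.symm)
    rcases pos_or K hKc hKv hx hy hD with h | h
    · exact absurd (pos_apex h3 hKc hKv hKi hx hy h) hyx
    · have hny : -y ∉ K := fun h' => hy (by simpa using hneg _ h')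
      have h' : posCone K x = posCone K (-y) := by
        rw [h]
        ext v
        constructor
        · rintro ⟨t, ht, k, hk, hv⟩
          refine ⟨t, ht, -k, hneg k hk, ?_⟩
          rw [← neg_neg v, hv]
          module
        · rintro ⟨t, ht, k, hk, hv⟩
          refine ⟨t, ht, -k, hneg k hk, ?_⟩
          rw [hv]
          module
      have := pos_apex h3 hKc hKv hKi hx hny h'
      rw [← this, neg_neg]
      exact hyL
  ext z
  constructor
  · intro hz
    exact ⟨-z, main z hz, neg_neg z⟩
  · rintro ⟨w, hw, rfl⟩
    exact main w hw
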